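/- arXiv:2302.13107 — 3 statements merged into one kernel-verified Lean document; each statement's English description precedes it below -/
import Mathlib

section
/- Let A be a C*-algebroid with unit with object set S. Then the following assertions are equivalent: (1) for every object s and every morphism x of A with source s there exists a ∈ A_s^s such that x*x = a*a; (2) there exist a family {H_s}_{s∈S} of complex Hilbert spaces and a *-representation Φ of A on it with identity aggregation map — that is, Φ assigns to every a ∈ A_s^t a bounded operator Φ(a) : H_s → H_t, linearly on each hom-set, with Φ(ab) = Φ(a)Φ(b) for composable a, b and Φ(a*) = Φ(a)* — which is injective on every hom-set; (3) for every n ∈ ℕ, the n-fold amplification ⁿA admits a system of complete norms making it a C*-algebroid and extending the norms of A, in the sense that for all n-tuples 𝐬, 𝐭 of objects and all indices j, k, the norm in ⁿA of the matrix whose (k, j) entry is a ∈ A_{s_j}^{t_k} and whose other entries are zero equals ‖a‖_{s_j,t_k}; (3') the assertion (3) holds for n = 2. -/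
open CategoryTheory
open scoped ComplexOrder

universe u v w x

variable (A : Type u) [Category.{v} A]
  [∀ s t : A, NormedAddCommGroup (s ⟶ t)] [∀ s t : A, NormedSpace ℂ (s ⟶ t)]

/-- A normed *-algebroid with unit: a small category whose hom-sets are complex Banach spaces,
with bilinear, submultiplicative composition and a conjugate-linear, antimultiplicative,
involutive star operation.  (For `b : s ⟶ u` and `a : u ⟶ t`, the product `ab` of the paper is
`b ≫ a`; completeness of the hom-sets is imposed separately by `CompleteSpace` instances.) -/
structure NormedStarAlgebroid where
  star : ∀ {s t : A}, (s ⟶ t) → (t ⟶ s)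
  star_comp : ∀ {s u t : A} (b : s ⟶ u) (a : u ⟶ t), star (b ≫ a) = star a ≫ star b
  star_star : ∀ {s t : A} (a : s ⟶ t), star (star a) = a
  star_add : ∀ {s t : A} (a b : s ⟶ t), star (a + b) = star a + star b
  star_smul : ∀ {s t : A} (c : ℂ) (a : s ⟶ t), star (c • a) = (starRingEnd ℂ c) • star a
  comp_add_left : ∀ {s u t : A} (b : s ⟶ u) (a a' : u ⟶ t), b ≫ (a + a') = b ≫ a + b ≫ a'
  comp_add_right : ∀ {s u t : A} (b b' : s ⟶ u) (a : u ⟶ t), (b + b') ≫ a = b ≫ a + b' ≫ a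
  comp_smul_left : ∀ {s u t : A} (c : ℂ) (b : s ⟶ u) (a : u ⟶ t), b ≫ (c • a) = c • (b ≫ a)
  comp_smul_right : ∀ {s u t : A} (c : ℂ) (b : s ⟶ u) (a : u ⟶ t), (c • b) ≫ a = c • (b ≫ a)
  norm_comp : ∀ {s u t : A} (b : s ⟶ u) (a : u ⟶ t), ‖b ≫ a‖ ≤ ‖a‖ * ‖b‖

/-- A `B*`-algebroid with unit: a normed *-algebroid (with complete hom-sets) whose involution
is isometric. -/
structure BStarAlgebroid extends NormedStarAlgebroid A where
  norm_star : ∀ {s t : A} (a : s ⟶ t), ‖star a‖ = ‖a‖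

/-- A `C*`-algebroid with unit: a normed *-algebroid (with complete hom-sets) whose norms
satisfy the `C*`-identity `‖a* a‖ = ‖a‖ ^ 2`. -/
structure CStarAlgebroid extends NormedStarAlgebroid A where
  norm_star_comp : ∀ {s t : A} (a : s ⟶ t), ‖a ≫ star a‖ = ‖a‖ ^ 2

variable {A} [∀ s t : A, CompleteSpace (s ⟶ t)] (ι : CStarAlgebroid A)

/-- A faithful *-representation of a `C*`-algebroid on a bundle of Hilbert spaces indexed by its
objects (identity aggregation map): an injective-on-hom-sets, hom-linear, multiplicative and
involution-preserving assignment of bounded operators. -/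
structure FaithfulRep where
  Hs : A → Type (max u v)
  [normH : ∀ s, NormedAddCommGroup (Hs s)]
  [ipsH : ∀ s, InnerProductSpace ℂ (Hs s)]
  [cmplH : ∀ s, CompleteSpace (Hs s)]
  Φ : ∀ {s t : A}, (s ⟶ t) → (Hs s →L[ℂ] Hs t)
  Φ_add : ∀ {s t : A} (a b : s ⟶ t), Φ (a + b) = Φ a + Φ b
  Φ_smul : ∀ {s t : A} (c : ℂ) (a : s ⟶ t), Φ (c • a) = c • Φ a
  Φ_mult : ∀ {s u t : A} (b : s ⟶ u) (a : u ⟶ t), Φ (b ≫ a) = (Φ a).comp (Φ b)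
  Φ_star : ∀ {s t : A} (a : s ⟶ t), Φ (ι.star a) = ContinuousLinearMap.adjoint (Φ a)
  inj : ∀ s t : A, Function.Injective (fun a : s ⟶ t => Φ a)

/-- The `n × n` matrix with the single entry `a : ss j ⟶ tt k` in position `(k, j)` and zeroes
elsewhere. -/
def singleMat {n : ℕ} (ss tt : Fin n → A) (k j : Fin n) (a : ss j ⟶ tt k) :
    ∀ i' j' : Fin n, ss j' ⟶ tt i' :=
  fun i' j' => if h : i' = k ∧ j' = j then cast (by rw [h.1, h.2]) a else 0

/-- A system of complete submultiplicative norms on the `n`-fold amplification `ⁿA` (whose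
morphisms `ss ⟶ tt` are the `n × n` matrices `M` with `M i j : ss j ⟶ tt i`, with matrix
composition and involution), satisfying the `C*`-identity and extending the norms of `A` with
respect to the canonical embeddings. -/
structure MatCStarNorm (n : ℕ) where
  N : ∀ (ss tt : Fin n → A), (∀ i j : Fin n, ss j ⟶ tt i) → ℝ
  eq_zero_iff : ∀ (ss tt : Fin n → A) (M : ∀ i j : Fin n, ss j ⟶ tt i),
    N ss tt M = 0 ↔ M = 0
  add_le : ∀ (ss tt : Fin n → A) (M M' : ∀ i j : Fin n, ss j ⟶ tt i),
    N ss tt (M + M') ≤ N ss tt M + N ss tt M'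
  smul_eq : ∀ (ss tt : Fin n → A) (c : ℂ) (M : ∀ i j : Fin n, ss j ⟶ tt i),
    N ss tt (c • M) = ‖c‖ * N ss tt M
  complete : ∀ (ss tt : Fin n → A) (f : ℕ → ∀ i j : Fin n, ss j ⟶ tt i),
    (∀ ε : ℝ, 0 < ε → ∃ M₀ : ℕ, ∀ p q : ℕ, M₀ ≤ p → M₀ ≤ q → N ss tt (f p - f q) < ε) →
    ∃ g : ∀ i j : Fin n, ss j ⟶ tt i,
      ∀ ε : ℝ, 0 < ε → ∃ M₀ : ℕ, ∀ p : ℕ, M₀ ≤ p → N ss tt (f p - g) < ε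
  submul : ∀ (ss uu tt : Fin n → A) (Ma : ∀ i j : Fin n, uu j ⟶ tt i)
    (Mb : ∀ i j : Fin n, ss j ⟶ uu i),
    N ss tt (fun i j => ∑ k, Mb k j ≫ Ma i k) ≤ N uu tt Ma * N ss uu Mb
  cstar : ∀ (ss tt : Fin n → A) (M : ∀ i j : Fin n, ss j ⟶ tt i),
    N ss ss (fun i j => ∑ k, M k j ≫ ι.star (M k i)) = (N ss tt M) ^ 2
  extends_norm : ∀ (ss tt : Fin n → A) (k j : Fin n) (a : ss j ⟶ tt k),
    N ss tt (singleMat ss tt k j a) = ‖a‖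

set_option linter.unusedSectionVars false

namespace CStarAlgebroid

/-- The isotropy algebra of a `C*`-algebroid at the object `s`, as a type synonym of `s ⟶ s` whose
product is `a * b = b ≫ a`. -/
def Isotropy (_ι : CStarAlgebroid A) (s : A) : Type v := s ⟶ s

section Isotropy

variable (s : A)

instance : NormedAddCommGroup (ι.Isotropy s) := inferInstanceAs (NormedAddCommGroup (s ⟶ s))

instance : NormedSpace ℂ (ι.Isotropy s) := inferInstanceAs (NormedSpace ℂ (s ⟶ s))

instance : CompleteSpace (ι.Isotropy s) := inferInstanceAs (CompleteSpace (s ⟶ s))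

instance : Mul (ι.Isotropy s) := ⟨fun a b => CategoryStruct.comp (obj := A) (X := s) b a⟩

instance : One (ι.Isotropy s) := ⟨𝟙 s⟩

instance : Star (ι.Isotropy s) := ⟨fun a => ι.star (s := s) (t := s) a⟩

end Isotropy

variable {s t u : A}

lemma comp_zero (ι : CStarAlgebroid A) (b : s ⟶ u) : b ≫ (0 : u ⟶ t) = 0 := by
  simpa using ι.comp_smul_left (0 : ℂ) b (0 : u ⟶ t)

lemma zero_comp (ι : CStarAlgebroid A) (a : u ⟶ t) : (0 : s ⟶ u) ≫ a = 0 := by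
  simpa using ι.comp_smul_right (0 : ℂ) (0 : s ⟶ u) a

lemma star_zero : ι.star (0 : s ⟶ t) = 0 := by
  simpa using ι.star_smul (0 : ℂ) (0 : s ⟶ t)

noncomputable instance : Ring (ι.Isotropy s) where
  __ := (inferInstance : AddCommGroup (ι.Isotropy s))
  left_distrib a b c := ι.comp_add_right (s := s) (u := s) (t := s) b c a
  right_distrib a b c := ι.comp_add_left (s := s) (u := s) (t := s) c a b
  zero_mul a := ι.comp_zero (s := s) (u := s) (t := s) a
  mul_zero a := ι.zero_comp (s := s) (u := s) (t := s) a
  mul_assoc a b c := (Category.assoc (W := s) (X := s) (Y := s) (Z := s) c b a).symm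
  one_mul a := Category.comp_id (X := s) (Y := s) a
  mul_one a := Category.id_comp (X := s) (Y := s) a

noncomputable instance : CStarAlgebra (ι.Isotropy s) where
  __ := (inferInstance : Ring (ι.Isotropy s))
  __ := (inferInstance : NormedAddCommGroup (ι.Isotropy s))
  __ := (inferInstance : NormedSpace ℂ (ι.Isotropy s))
  __ := (inferInstance : CompleteSpace (ι.Isotropy s))
  norm_mul_le a b := ι.norm_comp (s := s) (u := s) (t := s) b a
  star_involutive a := ι.star_star (s := s) (t := s) a
  star_mul a b := ι.star_comp (s := s) (u := s) (t := s) b a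
  star_add a b := ι.star_add (s := s) (t := s) a b
  norm_mul_self_le a := by
    rw [← sq]
    exact (ι.norm_star_comp (s := s) (t := s) a).ge
  star_smul c a := ι.star_smul (s := s) (t := s) c a
  algebraMap :=
    { toFun := fun c => c • 1
      map_one' := one_smul _ _
      map_zero' := zero_smul _ _
      map_add' := fun c d => add_smul c d _
      map_mul' := fun c d => by
        rw [mul_smul]
        refine Eq.trans ?_ (ι.comp_smul_left (s := s) (u := s) (t := s) c _ _).symm
        exact congrArg (c • ·) (Category.comp_id (X := s) (Y := s) _).symm }
  commutes' c a := by
    refine (ι.comp_smul_left (s := s) (u := s) (t := s) c _ _).trans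
      (Eq.trans ?_ (ι.comp_smul_right (s := s) (u := s) (t := s) c _ _).symm)
    exact congrArg (c • ·)
      ((Category.comp_id (X := s) (Y := s) _).trans (Category.id_comp (X := s) (Y := s) _).symm)
  smul_def' c a := by
    refine Eq.trans ?_ (ι.comp_smul_left (s := s) (u := s) (t := s) c _ _).symm
    exact congrArg (c • ·) (Category.comp_id (X := s) (Y := s) _).symm

noncomputable instance : PartialOrder (ι.Isotropy s) := CStarAlgebra.spectralOrder _

instance : StarOrderedRing (ι.Isotropy s) := CStarAlgebra.spectralOrderedRing _

/-- The isotropy-valued inner product `x* y` of two morphisms with the same source and target. -/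
def inner (x y : s ⟶ t) : ι.Isotropy s := y ≫ ι.star x

lemma star_inner (x y : s ⟶ t) : Star.star (ι.inner x y) = ι.inner y x := by
  change ι.star (y ≫ ι.star x) = _
  rw [ι.star_comp, ι.star_star, inner]

lemma inner_comp_comp (x y : s ⟶ t) (a b : ι.Isotropy s) :
    ι.inner (a ≫ x) (b ≫ y) = Star.star a * ι.inner x y * b := by
  have key (a b : s ⟶ s) : (b ≫ y) ≫ ι.star (a ≫ x) = b ≫ (y ≫ ι.star x) ≫ ι.star a := by
    rw [ι.star_comp, Category.assoc, Category.assoc]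
  exact key a b

lemma inner_self_eq_zero {x : s ⟶ t} : ι.inner x x = 0 ↔ x = 0 := by
  refine ⟨fun h => ?_, fun h => ?_⟩
  · have := ι.norm_star_comp x
    rw [show x ≫ ι.star x = 0 from h] at this
    simpa using this.symm
  · subst h
    exact ι.zero_comp _

/-- Every `x* x` is of the form `a* a` as soon as `x* x + y* y = 0` forces `y = 0`: the negative
part of `x* x` must vanish. -/
theorem exists_inner_self_eq
    (h : ∀ (s t : A) (x : s ⟶ t) (y : s ⟶ s), x ≫ ι.star x + y ≫ ι.star y = 0 → y = 0)
    (x : s ⟶ t) : ∃ a : s ⟶ s, x ≫ ι.star x = a ≫ ι.star a := by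
  set b : ι.Isotropy s := ι.inner x x with hb
  have hsa : IsSelfAdjoint b := ι.star_inner x x
  set n : ι.Isotropy s := b⁻ with hn
  have hn0 : 0 ≤ n := CFC.negPart_nonneg b
  have hnsa : Star.star n = n := (IsSelfAdjoint.of_nonneg hn0).star_eq
  set c : ι.Isotropy s := CFC.sqrt n with hc
  have hcc : c * c = n := CFC.sqrt_mul_sqrt_self n hn0
  have hcsa : Star.star c = c := (IsSelfAdjoint.of_nonneg (CFC.sqrt_nonneg n)).star_eq
  have hsum : Star.star n * b * n + Star.star (c * n) * (c * n) = 0 := by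
    rw [star_mul, hnsa, hcsa, mul_assoc n c, ← mul_assoc c c, hcc]
    calc n * b * n + n * (n * n) = n * (b⁺ - b⁻) * n + n * (n * n) := by
          rw [CFC.posPart_sub_negPart b hsa]
      _ = 0 := by rw [mul_sub, CFC.negPart_mul_posPart, ← hn]; noncomm_ring
  have hcn : c * n = 0 := h s t (n ≫ x) (c * n : ι.Isotropy s)
    (Eq.trans (congrArg (· + _) (ι.inner_comp_comp x x n n)) hsum)
  have hnn : Star.star n * n = 0 := by rw [hnsa]; nth_rw 1 [← hcc]; rw [mul_assoc, hcn, mul_zero]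
  have hn_zero : b⁻ = 0 := CStarRing.star_mul_self_eq_zero_iff n |>.1 hnn
  have hb0 : 0 ≤ b := (CFC.negPart_eq_zero_iff b hsa).1 hn_zero
  obtain ⟨a, ha⟩ := CStarAlgebra.nonneg_iff_eq_star_mul_self.1 hb0
  exact ⟨a, ha⟩

end CStarAlgebroid

section PositiveFunctional

variable {B : Type*} [CStarAlgebra B] [PartialOrder B] [StarOrderedRing B]

/-- Positive functionals on a `C*`-algebra detect nonzero positive elements. -/
theorem PositiveLinearMap.exists_apply_ne_zero {b : B} (hb : 0 ≤ b) (hb0 : b ≠ 0) :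
    ∃ f : B →ₚ[ℂ] ℂ, f b ≠ 0 := by
  let C : ProperCone ℝ B :=
    { carrier := {a : B | 0 ≤ a}
      add_mem' := fun ha hb => add_nonneg ha hb
      zero_mem' := le_refl (0 : B)
      smul_mem' := fun c a ha => smul_nonneg c.2 ha
      isClosed' := CStarAlgebra.isClosed_nonneg }
  have hnot : -b ∉ C := fun h : 0 ≤ -b => hb0 (le_antisymm (neg_nonneg.1 h) hb)
  obtain ⟨f, hf, hfb⟩ := C.hyperplane_separation_point hnot
  let g : B →ₗ[ℝ] ℝ := f.toLinearMap ∘ₗ (selfAdjoint.submodule ℝ B).subtype ∘ₗ realPart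
  let F : B →ₗ[ℂ] ℂ := Module.Dual.extendRCLike g
  have hF : ∀ a : B, 0 ≤ a → F a = f a := by
    intro a ha
    have hsa := IsSelfAdjoint.of_nonneg ha
    have hre : (realPart a : B) = a := hsa.coe_realPart
    have him : (realPart (Complex.I • a) : B) = 0 := by
      simpa using hsa
    have hg : g a = f a := congrArg f hre
    have hg_I : g (Complex.I • a) = 0 := (congrArg f him).trans (map_zero f)
    simp [F, Module.Dual.extendRCLike_apply, hg, hg_I]
  refine ⟨.mk₀ F fun a ha => ?_, ?_⟩
  · rw [hF a ha]
    exact_mod_cast hf a ha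
  · change F b ≠ 0
    rw [hF b hb]
    rw [map_neg, neg_lt_zero] at hfb
    exact_mod_cast hfb.ne'

end PositiveFunctional

section DirectSums

open scoped InnerProductSpace

section Lp

variable {I : Type*} {E F G : I → Type*}
  [∀ i, NormedAddCommGroup (E i)] [∀ i, InnerProductSpace ℂ (E i)]
  [∀ i, NormedAddCommGroup (F i)] [∀ i, InnerProductSpace ℂ (F i)]

/-- The diagonal operator between Hilbert sums determined by a uniformly bounded family of
operators. -/
noncomputable def lp.diagonalCLM (T : ∀ i, E i →L[ℂ] F i) (C : ℝ) (hT : ∀ i, ‖T i‖ ≤ C) :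
    lp E 2 →L[ℂ] lp F 2 :=
  have hle (x : lp E 2) (i : I) : ‖T i (x i)‖ ≤ C * ‖x i‖ := (T i).le_of_opNorm_le (hT i) (x i)
  LinearMap.mkContinuous
    { toFun := fun x => ⟨fun i => T i (x i),
        ((lp.memℓp x).norm.const_mul C).mono (hle x)⟩
      map_add' := fun x y => by ext i; exact map_add (T i) _ _
      map_smul' := fun c x => by ext i; exact map_smul (T i) _ _ }
    C fun x => by
      rcases isEmpty_or_nonempty I with hI | ⟨⟨i⟩⟩
      · rw [lp.eq_zero' x, map_zero, norm_zero, norm_zero, mul_zero]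
      have hC : 0 ≤ C := (norm_nonneg _).trans (hT i)
      refine lp.norm_le_of_tsum_le (by norm_num) (by positivity) ?_
      have hs := lp.hasSum_norm (p := 2) (by norm_num) x
      rw [Real.mul_rpow hC (norm_nonneg _), ← (hs.mul_left _).tsum_eq]
      refine Summable.tsum_le_tsum (fun i => ?_) ?_ (hs.mul_left _).summable
      · rw [← Real.mul_rpow hC (norm_nonneg _)]
        exact Real.rpow_le_rpow (norm_nonneg _) (hle x i) (by norm_num)
      · exact (((lp.memℓp x).norm.const_mul C).mono (hle x)).summable (by norm_num)

@[simp]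
lemma lp.diagonalCLM_apply (T : ∀ i, E i →L[ℂ] F i) (C : ℝ) (hT : ∀ i, ‖T i‖ ≤ C)
    (x : lp E 2) (i : I) : lp.diagonalCLM T C hT x i = T i (x i) := rfl

lemma lp.adjoint_diagonalCLM [∀ i, CompleteSpace (E i)] [∀ i, CompleteSpace (F i)]
    (T : ∀ i, E i →L[ℂ] F i) (S : ∀ i, F i →L[ℂ] E i) (C D : ℝ)
    (hT : ∀ i, ‖T i‖ ≤ C) (hS : ∀ i, ‖S i‖ ≤ D)
    (hST : ∀ i, S i = ContinuousLinearMap.adjoint (T i)) :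
    lp.diagonalCLM S D hS = ContinuousLinearMap.adjoint (lp.diagonalCLM T C hT) := by
  refine (ContinuousLinearMap.eq_adjoint_iff _ _).2 fun x y => ?_
  simp [lp.inner_eq_tsum, hST, ContinuousLinearMap.adjoint_inner_left]

end Lp

section PiLp

variable {n : Type*} [Fintype n] {E F G : n → Type*}
  [∀ i, NormedAddCommGroup (E i)] [∀ i, InnerProductSpace ℂ (E i)]
  [∀ i, NormedAddCommGroup (F i)] [∀ i, InnerProductSpace ℂ (F i)]
  [∀ i, NormedAddCommGroup (G i)] [∀ i, InnerProductSpace ℂ (G i)]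

/-- The inclusion of a summand into a finite Hilbert sum, as a continuous linear map. -/
noncomputable def PiLp.singleCLM [DecidableEq n] (E : n → Type*) [∀ i, NormedAddCommGroup (E i)]
    [∀ i, InnerProductSpace ℂ (E i)] (i : n) : E i →L[ℂ] PiLp 2 E :=
  LinearMap.mkContinuous
    { toFun := PiLp.single 2 i
      map_add' := fun _ _ => PiLp.single_add 2 i
      map_smul' := fun c a => PiLp.ext fun j => (congrFun (Pi.single_smul i c a) j) }
    1 fun x => by simp

@[simp]
lemma PiLp.singleCLM_apply [DecidableEq n] (i : n) (x : E i) :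
    PiLp.singleCLM E i x = PiLp.single 2 i x := rfl

lemma PiLp.norm_singleCLM_le [DecidableEq n] (i : n) : ‖PiLp.singleCLM E i‖ ≤ 1 :=
  LinearMap.mkContinuous_norm_le _ zero_le_one _

lemma PiLp.norm_proj_le (i : n) :
    ‖(PiLp.proj 2 E i : PiLp 2 E →L[ℂ] E i)‖ ≤ 1 :=
  ContinuousLinearMap.opNorm_le_bound _ zero_le_one fun x => by
    simpa using PiLp.norm_apply_le x i

open Classical in
/-- The operator between finite Hilbert sums with the given matrix of operators. -/
noncomputable def PiLp.blockCLM (T : ∀ i j, E j →L[ℂ] F i) : PiLp 2 E →L[ℂ] PiLp 2 F :=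
  ∑ i, ∑ j, PiLp.singleCLM F i ∘L T i j ∘L PiLp.proj 2 E j

@[simp]
lemma PiLp.blockCLM_apply (T : ∀ i j, E j →L[ℂ] F i) (x : PiLp 2 E) (i : n) :
    PiLp.blockCLM T x i = ∑ j, T i j (x j) := by
  classical
  rw [PiLp.blockCLM]
  simp only [sum_apply, ContinuousLinearMap.comp_apply, WithLp.ofLp_sum,
    Finset.sum_apply]
  rw [Finset.sum_eq_single i]
  · simp
  · intro k _ hk
    simp [hk.symm]
  · simp

lemma PiLp.norm_blockCLM_add_le (T S : ∀ i j, E j →L[ℂ] F i) :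
    ‖PiLp.blockCLM (fun i j => T i j + S i j)‖ ≤ ‖PiLp.blockCLM T‖ + ‖PiLp.blockCLM S‖ := by
  rw [show PiLp.blockCLM (fun i j => T i j + S i j) = PiLp.blockCLM T + PiLp.blockCLM S by
    ext x i
    simp [Finset.sum_add_distrib]]
  exact norm_add_le (PiLp.blockCLM T) (PiLp.blockCLM S)

lemma PiLp.norm_blockCLM_smul (c : ℂ) (T : ∀ i j, E j →L[ℂ] F i) :
    ‖PiLp.blockCLM (fun i j => c • T i j)‖ = ‖c‖ * ‖PiLp.blockCLM T‖ := by
  rw [show PiLp.blockCLM (fun i j => c • T i j) = c • PiLp.blockCLM T by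
    ext x i
    simp [Finset.smul_sum]]
  have hsmul {V W : Type _} [NormedAddCommGroup V] [NormedSpace ℂ V] [NormedAddCommGroup W]
      [NormedSpace ℂ W] (S : V →L[ℂ] W) : ‖c • S‖ = ‖c‖ * ‖S‖ := norm_smul c S
  exact hsmul (PiLp.blockCLM T)

lemma PiLp.blockCLM_comp (T : ∀ i j, F j →L[ℂ] G i) (S : ∀ i j, E j →L[ℂ] F i) :
    PiLp.blockCLM T ∘L PiLp.blockCLM S = PiLp.blockCLM fun i j => ∑ k, T i k ∘L S k j := by
  ext x i
  simp only [ContinuousLinearMap.comp_apply, PiLp.blockCLM_apply, map_sum,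
    sum_apply]
  exact Finset.sum_comm

lemma PiLp.adjoint_blockCLM [∀ i, CompleteSpace (E i)] [∀ i, CompleteSpace (F i)]
    (T : ∀ i j, E j →L[ℂ] F i) :
    PiLp.blockCLM (fun j i => ContinuousLinearMap.adjoint (T i j)) =
      ContinuousLinearMap.adjoint (PiLp.blockCLM T) := by
  refine (ContinuousLinearMap.eq_adjoint_iff _ _).2 fun x y => ?_
  simp only [PiLp.inner_apply, PiLp.blockCLM_apply, sum_inner, inner_sum,
    ContinuousLinearMap.adjoint_inner_left]
  exact Finset.sum_comm

lemma PiLp.proj_comp_blockCLM_comp_singleCLM [DecidableEq n] (T : ∀ i j, E j →L[ℂ] F i)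
    (i j : n) : PiLp.proj 2 F i ∘L PiLp.blockCLM T ∘L PiLp.singleCLM E j = T i j := by
  ext x
  simp only [ContinuousLinearMap.comp_apply, PiLp.proj_apply, PiLp.blockCLM_apply,
    PiLp.singleCLM_apply]
  rw [Finset.sum_eq_single j]
  · simp
  · intro k _ hk
    simp [hk]
  · simp

lemma PiLp.norm_le_norm_blockCLM (T : ∀ i j, E j →L[ℂ] F i) (i j : n) :
    ‖T i j‖ ≤ ‖PiLp.blockCLM T‖ := by
  classical
  calc ‖T i j‖ = ‖PiLp.proj 2 F i ∘L PiLp.blockCLM T ∘L PiLp.singleCLM E j‖ := by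
        rw [PiLp.proj_comp_blockCLM_comp_singleCLM]
    _ ≤ 1 * (‖PiLp.blockCLM T‖ * 1) := by
        refine (ContinuousLinearMap.opNorm_comp_le _ _).trans ?_
        gcongr
        · exact PiLp.norm_proj_le i
        · refine (ContinuousLinearMap.opNorm_comp_le _ _).trans ?_
          gcongr
          exact PiLp.norm_singleCLM_le j
    _ = _ := by ring

lemma PiLp.norm_blockCLM_le_sum (T : ∀ i j, E j →L[ℂ] F i) :
    ‖PiLp.blockCLM T‖ ≤ ∑ i, ∑ j, ‖T i j‖ := by
  classical
  rw [PiLp.blockCLM]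
  have hsum (S : n → n → PiLp 2 E →L[ℂ] PiLp 2 F) :
      ‖∑ i, ∑ j, S i j‖ ≤ ∑ i, ∑ j, ‖S i j‖ :=
    (norm_sum_le Finset.univ fun i => ∑ j, S i j).trans
      (Finset.sum_le_sum fun i _ => norm_sum_le Finset.univ (S i))
  refine (hsum _).trans (Finset.sum_le_sum fun i _ => Finset.sum_le_sum fun j _ => ?_)
  calc ‖PiLp.singleCLM F i ∘L T i j ∘L PiLp.proj 2 E j‖ ≤ 1 * (‖T i j‖ * 1) := by
        refine (ContinuousLinearMap.opNorm_comp_le _ _).trans ?_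
        gcongr
        · exact PiLp.norm_singleCLM_le i
        · refine (ContinuousLinearMap.opNorm_comp_le _ _).trans ?_
          gcongr
          exact PiLp.norm_proj_le j
    _ = _ := by ring

end PiLp

end DirectSums

namespace CStarAlgebroid

open scoped InnerProductSpace
open UniformSpace

variable {s t u : A}

lemma inner_add_left (x y z : s ⟶ t) : ι.inner (x + y) z = ι.inner x z + ι.inner y z := by
  rw [inner, ι.star_add, ι.comp_add_left]
  rfl

lemma inner_smul_left (c : ℂ) (x y : s ⟶ t) :
    ι.inner (c • x) y = starRingEnd ℂ c • ι.inner x y := by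
  rw [inner, ι.star_smul, ι.comp_smul_left]
  rfl

/-- The condition that `x* x` is a nonnegative element of the isotropy algebra for all
morphisms `x`. -/
def InnerNonneg : Prop := ∀ (s t : A) (x : s ⟶ t), 0 ≤ ι.inner x x

variable {ι}

/-- Composition with `c` is bounded by `‖c‖` for the isotropy-valued inner product. -/
lemma InnerNonneg.inner_comp_le (h : ι.InnerNonneg) (x : s ⟶ t) (c : t ⟶ u) :
    ι.inner (x ≫ c) (x ≫ c) ≤ ((‖c‖ ^ 2 : ℝ) : ℂ) • ι.inner x x := by
  set r : ℂ := ((‖c‖ ^ 2 : ℝ) : ℂ) with hr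
  set p : ι.Isotropy t := ι.inner c c with hp
  have hp0 : 0 ≤ p := h t u c
  have hnorm : ‖p‖ = ‖c‖ ^ 2 := ι.norm_star_comp c
  have hle : p ≤ r • (1 : ι.Isotropy t) := by
    have := (IsSelfAdjoint.of_nonneg hp0).le_algebraMap_norm_self
    rwa [hnorm, Algebra.algebraMap_eq_smul_one, ← Complex.coe_smul] at this
  have hq0 : 0 ≤ r • (1 : ι.Isotropy t) - p := sub_nonneg.2 hle
  obtain ⟨d, hd⟩ := CStarAlgebra.nonneg_iff_eq_star_mul_self.1 hq0
  have hadd : (c ≫ ι.star c) + (show t ⟶ t from d) ≫ ι.star (show t ⟶ t from d) =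
      r • 𝟙 t := by
    have : p + Star.star d * d = r • (1 : ι.Isotropy t) := by rw [← hd]; abel
    exact this
  have hsplit : ι.inner (x ≫ c) (x ≫ c) +
      ι.inner (x ≫ (show t ⟶ t from d)) (x ≫ (show t ⟶ t from d)) = r • ι.inner x x := by
    have key : (x ≫ c) ≫ ι.star (x ≫ c) +
        (x ≫ (show t ⟶ t from d)) ≫ ι.star (x ≫ (show t ⟶ t from d)) = r • (x ≫ ι.star x) := by
      have hassoc {v : A} (e : t ⟶ v) :
          (x ≫ e) ≫ ι.star (x ≫ e) = x ≫ (e ≫ ι.star e) ≫ ι.star x := by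
        simp only [ι.star_comp, Category.assoc]
      rw [hassoc, hassoc, ← ι.comp_add_left, ← ι.comp_add_right, hadd, ι.comp_smul_right,
        Category.id_comp, ι.comp_smul_left]
    exact key
  rw [← hsplit]
  exact le_add_of_nonneg_right (h s t _)

/-- The space `s ⟶ t`, to be equipped with the semi-inner product `⟪x, y⟫ = f (x* y)` of a positive
functional `f` on the isotropy algebra at `s`. -/
def PreGNS (_h : ι.InnerNonneg) {s : A} (_f : ι.Isotropy s →ₚ[ℂ] ℂ) (t : A) : Type v := s ⟶ t

section PreGNS

variable (h : ι.InnerNonneg) (f : ι.Isotropy s →ₚ[ℂ] ℂ)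

instance : AddCommGroup (PreGNS h f t) := inferInstanceAs (AddCommGroup (s ⟶ t))

noncomputable instance : Module ℂ (PreGNS h f t) := inferInstanceAs (Module ℂ (s ⟶ t))

/-- The semi-inner product `⟪x, y⟫ = f (x* y)` on `s ⟶ t`. -/
noncomputable abbrev preGNSCore (t : A) : PreInnerProductSpace.Core ℂ (PreGNS h f t) where
  inner x y := f (ι.inner (s := s) (t := t) x y)
  conj_inner_symm x y := by
    rw [← ι.star_inner (s := s) (t := t) y x, map_star f]
    rfl
  re_inner_nonneg x := (RCLike.nonneg_iff.mp (f.map_nonneg (h s t x))).1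
  add_left x y z := (congrArg f (ι.inner_add_left (s := s) (t := t) x y z)).trans (map_add f _ _)
  smul_left x y c := (congrArg f (ι.inner_smul_left (s := s) (t := t) c x y)).trans (map_smul f _ _)

noncomputable instance : SeminormedAddCommGroup (PreGNS h f t) :=
  InnerProductSpace.Core.toSeminormedAddCommGroup (c := preGNSCore h f t)

noncomputable instance : InnerProductSpace ℂ (PreGNS h f t) :=
  InnerProductSpace.ofCore (preGNSCore h f t)

/-- Composition with `c`, as an operator between pre-GNS spaces. -/
noncomputable def preGNSMap (c : t ⟶ u) : PreGNS h f t →L[ℂ] PreGNS h f u :=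
  LinearMap.mkContinuous
    { toFun := fun x => CategoryStruct.comp (obj := A) (X := s) (Y := t) x c
      map_add' := fun x y => ι.comp_add_right (s := s) (u := t) x y c
      map_smul' := fun r x => ι.comp_smul_right (s := s) (u := t) r x c }
    ‖c‖ fun x => by
      refine le_of_sq_le_sq ?_ (by positivity)
      rw [mul_pow, ← inner_self_eq_norm_sq (𝕜 := ℂ), ← inner_self_eq_norm_sq (𝕜 := ℂ) x]
      have := OrderHomClass.mono f (h.inner_comp_le (s := s) (t := t) x c)
      rw [map_smul] at this
      have := (Complex.le_def.1 this).1
      rwa [smul_eq_mul, Complex.re_ofReal_mul] at this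

lemma norm_preGNSMap_le (c : t ⟶ u) : ‖preGNSMap h f c‖ ≤ ‖c‖ :=
  LinearMap.mkContinuous_norm_le _ (norm_nonneg c) _

lemma inner_preGNSMap_star (c : t ⟶ u) (y : PreGNS h f u) (x : PreGNS h f t) :
    ⟪preGNSMap h f (ι.star c) y, x⟫_ℂ = ⟪y, preGNSMap h f c x⟫_ℂ := by
  have key (y : s ⟶ u) (x : s ⟶ t) : x ≫ ι.star (y ≫ ι.star c) = (x ≫ c) ≫ ι.star y := by
    rw [ι.star_comp, ι.star_star, Category.assoc]
  exact congrArg f (key y x)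

/-- Composition with `c`, as an operator between GNS spaces. -/
noncomputable def gnsMap (c : t ⟶ u) :
    Completion (PreGNS h f t) →L[ℂ] Completion (PreGNS h f u) :=
  (preGNSMap h f c).completion

lemma gnsMap_coe (c : t ⟶ u) (x : PreGNS h f t) :
    gnsMap h f c (x : Completion (PreGNS h f t)) = (preGNSMap h f c x : PreGNS h f u) :=
  ContinuousLinearMap.completion_apply_coe _ _

lemma norm_gnsMap_le (c : t ⟶ u) : ‖gnsMap h f c‖ ≤ ‖c‖ := by
  refine ContinuousLinearMap.opNorm_le_bound _ (norm_nonneg c) fun x => ?_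
  induction x using Completion.induction_on with
  | hp => exact isClosed_le (by fun_prop) (by fun_prop)
  | ih x =>
    rw [gnsMap_coe, Completion.norm_coe, Completion.norm_coe]
    exact (preGNSMap h f c).le_of_opNorm_le (norm_preGNSMap_le h f c) x

lemma gnsMap_ext {T S : Completion (PreGNS h f t) →L[ℂ] Completion (PreGNS h f u)}
    (hTS : ∀ x : PreGNS h f t, T x = S x) : T = S := by
  ext x
  induction x using Completion.induction_on with
  | hp => exact isClosed_eq (by fun_prop) (by fun_prop)
  | ih x => exact hTS x

lemma gnsMap_add (c d : t ⟶ u) : gnsMap h f (c + d) = gnsMap h f c + gnsMap h f d := by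
  refine gnsMap_ext h f fun x => ?_
  rw [add_apply]
  simp only [gnsMap_coe]
  rw [← Completion.coe_add]
  exact congrArg _ (ι.comp_add_left (s := s) (u := t) x c d)

lemma gnsMap_smul (r : ℂ) (c : t ⟶ u) : gnsMap h f (r • c) = r • gnsMap h f c := by
  refine gnsMap_ext h f fun x => ?_
  rw [smul_apply]
  simp only [gnsMap_coe]
  rw [← Completion.coe_smul]
  exact congrArg _ (ι.comp_smul_left (s := s) (u := t) r x c)

lemma gnsMap_comp {v : A} (c : t ⟶ u) (d : u ⟶ v) :
    gnsMap h f (c ≫ d) = gnsMap h f d ∘L gnsMap h f c := by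
  refine gnsMap_ext h f fun x => ?_
  rw [ContinuousLinearMap.comp_apply]
  simp only [gnsMap_coe]
  exact congrArg _ (Category.assoc (W := s) (X := t) x c d).symm

lemma gnsMap_star (c : t ⟶ u) :
    gnsMap h f (ι.star c) = ContinuousLinearMap.adjoint (gnsMap h f c) := by
  refine (ContinuousLinearMap.eq_adjoint_iff _ _).2 fun y x => ?_
  induction y, x using Completion.induction_on₂ with
  | hp => exact isClosed_eq (by fun_prop) (by fun_prop)
  | ih y x =>
    rw [gnsMap_coe, gnsMap_coe, Completion.inner_coe, Completion.inner_coe]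
    exact inner_preGNSMap_star h f c y x

/-- The vector of the identity morphism recovers the functional. -/
lemma apply_inner_self_eq_zero {c : s ⟶ t} (hc : gnsMap h f c = 0) : f (ι.inner c c) = 0 := by
  let x : PreGNS h f s := 𝟙 s
  have hx : preGNSMap h f c x = (show PreGNS h f t from c) :=
    Category.id_comp (X := s) (Y := t) c
  have h1 : (preGNSMap h f c x : Completion (PreGNS h f t)) = 0 := by
    rw [← gnsMap_coe, hc, zero_apply]
  have h2 := _root_.inner_self_eq_zero (𝕜 := ℂ).2 h1
  rw [Completion.inner_coe, hx] at h2
  exact h2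

end PreGNS

/-- If `0 ≤ x* x` for all morphisms `x`, then the sum of the GNS representations of all positive
functionals on isotropy algebras is faithful. -/
noncomputable def InnerNonneg.faithfulRep (h : ι.InnerNonneg) : FaithfulRep ι where
  Hs t := lp (fun i : Σ s : A, (ι.Isotropy s →ₚ[ℂ] ℂ) => Completion (PreGNS h i.2 t)) 2
  Φ c := lp.diagonalCLM (fun i => gnsMap h i.2 c) ‖c‖ fun i => norm_gnsMap_le h i.2 c
  Φ_add c d := by
    ext x i
    exact congrArg (· (x i)) (gnsMap_add h i.2 c d)
  Φ_smul r c := by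
    ext x i
    exact congrArg (· (x i)) (gnsMap_smul h i.2 r c)
  Φ_mult c d := by
    ext x i
    exact congrArg (· (x i)) (gnsMap_comp h i.2 c d)
  Φ_star c := lp.adjoint_diagonalCLM _ _ _ _ _ _ fun i => gnsMap_star h i.2 c
  inj t u c d hcd := by
    classical
    have hmap (f : ι.Isotropy t →ₚ[ℂ] ℂ) : gnsMap h f c = gnsMap h f d := by
      ext x
      have := congrArg (fun T => T (lp.single 2 (⟨t, f⟩ : Σ s : A, (ι.Isotropy s →ₚ[ℂ] ℂ)) x) ⟨t, f⟩)
        hcd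
      simpa using this
    by_contra hne
    set e : t ⟶ u := c - d with he
    have hcde : c = e + d := by rw [he]; abel
    have hzero (f : ι.Isotropy t →ₚ[ℂ] ℂ) : gnsMap h f e = 0 := by
      have := hmap f
      rw [hcde, gnsMap_add] at this
      simpa using this
    obtain ⟨f, hf⟩ := PositiveLinearMap.exists_apply_ne_zero (h t u e)
      (mt ι.inner_self_eq_zero.1 (sub_ne_zero.2 hne))
    exact hf (apply_inner_self_eq_zero h f (hzero f))

end CStarAlgebroid

section MatrixNorm

variable {ι}

namespace FaithfulRep

variable (R : FaithfulRep ι) {s t : A}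

attribute [instance] normH ipsH cmplH

lemma Φ_zero : R.Φ (0 : s ⟶ t) = 0 := by
  simpa using R.Φ_smul (0 : ℂ) (0 : s ⟶ t)

lemma Φ_sum {κ : Type*} (S : Finset κ) (a : κ → (s ⟶ t)) :
    R.Φ (∑ k ∈ S, a k) = ∑ k ∈ S, R.Φ (a k) :=
  map_sum (AddMonoidHom.mk' R.Φ R.Φ_add) a S

lemma eq_zero_of_Φ_eq_zero {a : s ⟶ t} (ha : R.Φ a = 0) : a = 0 :=
  R.inj s t (ha.trans R.Φ_zero.symm)

/-- The restriction of a representation to an isotropy algebra. -/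
noncomputable def isotropyHom (s : A) : ι.Isotropy s →⋆ₙₐ[ℂ] (R.Hs s →L[ℂ] R.Hs s) where
  toFun a := R.Φ (s := s) (t := s) a
  map_smul' c a := R.Φ_smul (s := s) (t := s) c a
  map_zero' := R.Φ_zero (s := s) (t := s)
  map_add' a b := R.Φ_add (s := s) (t := s) a b
  map_mul' a b := R.Φ_mult (s := s) (u := s) (t := s) b a
  map_star' a := R.Φ_star (s := s) (t := s) a

/-- Faithful representations are isometric. -/
lemma norm_Φ (a : s ⟶ t) : ‖R.Φ a‖ = ‖a‖ := by
  have h1 : ‖R.Φ (a ≫ ι.star a)‖ = ‖a ≫ ι.star a‖ :=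
    NonUnitalStarAlgHom.norm_map (A := ι.Isotropy s) (R.isotropyHom s) (R.inj s s) (ι.inner a a)
  rw [R.Φ_mult, R.Φ_star, ContinuousLinearMap.norm_adjoint_comp_self, ι.norm_star_comp,
    ← sq] at h1
  exact (pow_left_inj₀ (norm_nonneg _) (norm_nonneg _) two_ne_zero).1 h1

/-- If `x* x + y* y = 0` in a represented `C*`-algebroid, then `y = 0`. -/
lemma eq_zero_of_add_eq_zero (R : FaithfulRep ι) {x : s ⟶ t} {y : s ⟶ s}
    (h : x ≫ ι.star x + y ≫ ι.star y = 0) : y = 0 := by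
  refine R.eq_zero_of_Φ_eq_zero (ContinuousLinearMap.ext fun v => ?_)
  have hv := congrArg (fun T : R.Hs s →L[ℂ] R.Hs s => RCLike.re (inner ℂ (T v) v))
    ((congrArg R.Φ h).trans R.Φ_zero)
  simp only [R.Φ_add, R.Φ_mult, R.Φ_star, add_apply,
    ContinuousLinearMap.comp_apply, inner_add_left, ContinuousLinearMap.adjoint_inner_left,
    zero_apply, inner_zero_left, map_add, inner_self_eq_norm_sq, map_zero] at hv
  have : ‖R.Φ y v‖ ^ 2 = 0 := by nlinarith [sq_nonneg ‖R.Φ x v‖, sq_nonneg ‖R.Φ y v‖]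
  simpa using this

variable {n : ℕ}

/-- The operator between finite Hilbert sums represented by a matrix of morphisms. -/
noncomputable def matrixCLM (ss tt : Fin n → A) (M : ∀ i j : Fin n, ss j ⟶ tt i) :
    PiLp 2 (fun j => R.Hs (ss j)) →L[ℂ] PiLp 2 (fun i => R.Hs (tt i)) :=
  PiLp.blockCLM (E := fun j => R.Hs (ss j)) (F := fun i => R.Hs (tt i)) fun i j => R.Φ (M i j)

variable (ss uu tt : Fin n → A)

lemma norm_le_norm_matrixCLM (M : ∀ i j : Fin n, ss j ⟶ tt i) (i j : Fin n) :
    ‖M i j‖ ≤ ‖R.matrixCLM ss tt M‖ := by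
  rw [← R.norm_Φ]
  exact PiLp.norm_le_norm_blockCLM (E := fun j => R.Hs (ss j)) (F := fun i => R.Hs (tt i))
    (fun i j => R.Φ (M i j)) i j

lemma norm_matrixCLM_le_sum (M : ∀ i j : Fin n, ss j ⟶ tt i) :
    ‖R.matrixCLM ss tt M‖ ≤ ∑ i, ∑ j, ‖M i j‖ := by
  simp only [← R.norm_Φ]
  exact PiLp.norm_blockCLM_le_sum (E := fun j => R.Hs (ss j)) (F := fun i => R.Hs (tt i)) _

lemma norm_matrixCLM_add_le (M M' : ∀ i j : Fin n, ss j ⟶ tt i) :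
    ‖R.matrixCLM ss tt (M + M')‖ ≤ ‖R.matrixCLM ss tt M‖ + ‖R.matrixCLM ss tt M'‖ := by
  simp only [matrixCLM, Pi.add_apply, R.Φ_add]
  exact PiLp.norm_blockCLM_add_le (E := fun j => R.Hs (ss j)) (F := fun i => R.Hs (tt i)) _ _

lemma norm_matrixCLM_smul (c : ℂ) (M : ∀ i j : Fin n, ss j ⟶ tt i) :
    ‖R.matrixCLM ss tt (c • M)‖ = ‖c‖ * ‖R.matrixCLM ss tt M‖ := by
  simp only [matrixCLM, Pi.smul_apply, R.Φ_smul]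
  exact PiLp.norm_blockCLM_smul (E := fun j => R.Hs (ss j)) (F := fun i => R.Hs (tt i)) _ _

lemma matrixCLM_comp (Ma : ∀ i j : Fin n, uu j ⟶ tt i) (Mb : ∀ i j : Fin n, ss j ⟶ uu i) :
    R.matrixCLM ss tt (fun i j => ∑ k, Mb k j ≫ Ma i k) =
      R.matrixCLM uu tt Ma ∘L R.matrixCLM ss uu Mb := by
  refine Eq.trans ?_ (PiLp.blockCLM_comp (E := fun j => R.Hs (ss j)) (F := fun i => R.Hs (uu i))
    (G := fun i => R.Hs (tt i)) _ _).symm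
  simp only [matrixCLM, R.Φ_sum, R.Φ_mult]

lemma matrixCLM_star (M : ∀ i j : Fin n, ss j ⟶ tt i) :
    R.matrixCLM tt ss (fun j i => ι.star (M i j)) =
      ContinuousLinearMap.adjoint (R.matrixCLM ss tt M) := by
  refine Eq.trans ?_ (PiLp.adjoint_blockCLM (E := fun j => R.Hs (ss j))
    (F := fun i => R.Hs (tt i)) _)
  simp only [matrixCLM, R.Φ_star]

/-- A faithful representation induces a `C*`-norm on every finite amplification. -/
noncomputable def matCStarNorm (n : ℕ) : MatCStarNorm ι n where
  N ss tt M := ‖R.matrixCLM ss tt M‖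
  eq_zero_iff ss tt M := by
    refine ⟨fun h => ?_, fun h => ?_⟩
    · ext i j
      exact norm_le_zero_iff.1 ((R.norm_le_norm_matrixCLM ss tt M i j).trans_eq h)
    · subst h
      exact le_antisymm ((R.norm_matrixCLM_le_sum ss tt 0).trans_eq (by simp))
        (ContinuousLinearMap.opNorm_nonneg _)
  add_le ss tt M M' := R.norm_matrixCLM_add_le ss tt M M'
  smul_eq ss tt c M := R.norm_matrixCLM_smul ss tt c M
  complete ss tt f hf := by
    have hcauchy (i j : Fin n) : CauchySeq fun p => f p i j := by
      refine Metric.cauchySeq_iff.2 fun ε hε => ?_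
      obtain ⟨K, hK⟩ := hf ε hε
      refine ⟨K, fun p hp q hq => ?_⟩
      rw [dist_eq_norm]
      exact (R.norm_le_norm_matrixCLM ss tt (f p - f q) i j).trans_lt (hK p q hp hq)
    choose g hg using fun i j => cauchySeq_tendsto_of_complete (hcauchy i j)
    refine ⟨g, fun ε hε => ?_⟩
    have hsum : Filter.Tendsto (fun p => ∑ i, ∑ j, ‖f p i j - g i j‖) Filter.atTop (nhds 0) := by
      rw [show (0 : ℝ) = ∑ i : Fin n, ∑ j : Fin n, 0 by simp]
      exact tendsto_finsetSum _ fun i _ => tendsto_finsetSum _ fun j _ =>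
        tendsto_iff_norm_sub_tendsto_zero.1 (hg i j)
    obtain ⟨K, hK⟩ := Filter.eventually_atTop.1 (hsum.eventually_lt_const hε)
    exact ⟨K, fun p hp => (R.norm_matrixCLM_le_sum ss tt (f p - g)).trans_lt (hK p hp)⟩
  submul ss uu tt Ma Mb := by
    rw [R.matrixCLM_comp]
    exact ContinuousLinearMap.opNorm_comp_le _ _
  cstar ss tt M := by
    rw [R.matrixCLM_comp ss tt ss (fun i k => ι.star (M k i)) M, R.matrixCLM_star,
      ContinuousLinearMap.norm_adjoint_comp_self, sq]
  extends_norm ss tt k j a := by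
    have hkj : singleMat ss tt k j a k j = a := by simp [singleMat]
    refine le_antisymm ((R.norm_matrixCLM_le_sum ss tt _).trans_eq ?_) ?_
    · rw [Finset.sum_eq_single k, Finset.sum_eq_single j, hkj]
      · intro j' _ hj'
        simp [singleMat, hj']
      · simp
      · intro i' _ hi'
        simp [singleMat, hi']
      · simp
    · simpa only [hkj] using R.norm_le_norm_matrixCLM ss tt (singleMat ss tt k j a) k j

end FaithfulRep

/-- If the second amplification carries a `C*`-norm, then `x* x + y* y = 0` forces `y = 0`: the
matrix with first column `(y, x)` has vanishing square. -/
lemma MatCStarNorm.eq_zero_of_add_eq_zero (ν : MatCStarNorm ι 2) {s t : A} {x : s ⟶ t}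
    {y : s ⟶ s} (h : x ≫ ι.star x + y ≫ ι.star y = 0) : y = 0 := by
  let ss : Fin 2 → A := fun _ => s
  let tt : Fin 2 → A := Fin.cons s fun _ => t
  let M : ∀ i j : Fin 2, ss j ⟶ tt i := fun i j =>
    if j = 0 then Fin.cases (motive := fun i => s ⟶ tt i) y (fun _ => x) i else 0
  have hM : (fun i j => ∑ k, M k j ≫ ι.star (M k i)) = (0 : ∀ i j : Fin 2, ss j ⟶ ss i) := by
    funext i j
    rw [Fin.sum_univ_two]
    by_cases hj : j = 0
    · by_cases hi : i = 0
      · subst hi hj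
        exact (add_comm _ _).trans h
      · simp only [M, hi, if_false, ι.star_zero, ι.comp_zero]
        exact add_zero _
    · simp only [M, hj, if_false, ι.zero_comp]
      exact add_zero _
  have hN := ν.cstar ss tt M
  rw [hM, (ν.eq_zero_iff ss ss 0).2 rfl] at hN
  have hM0 : M = 0 := (ν.eq_zero_iff ss tt M).1 (pow_eq_zero_iff two_ne_zero |>.1 hN.symm)
  exact congrFun (congrFun hM0 0) 0

end MatrixNorm

/-- Theorem 6.9 of the paper. For a `C*`-algebroid with unit the following
are equivalent: (1) for every morphism `x` with source `s` there is `a ∈ A_s^s` with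
`x* x = a* a`; (2) `A` admits a faithful *-representation on a bundle of Hilbert spaces with
identity aggregation map; (3) every `n`-fold amplification `ⁿA` carries a system of complete
norms making it a `C*`-algebroid and extending the norms of `A`; (3') assertion (3) for
`n = 2`. -/
theorem cStarAlgebroid_questions_equivalent :
    ((∀ (s t : A) (x : s ⟶ t), ∃ a : s ⟶ s, x ≫ ι.star x = a ≫ ι.star a) ↔
      Nonempty (FaithfulRep ι)) ∧
    ((∀ (s t : A) (x : s ⟶ t), ∃ a : s ⟶ s, x ≫ ι.star x = a ≫ ι.star a) ↔
      ∀ n : ℕ, Nonempty (MatCStarNorm ι n)) ∧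
    ((∀ (s t : A) (x : s ⟶ t), ∃ a : s ⟶ s, x ≫ ι.star x = a ≫ ι.star a) ↔
      Nonempty (MatCStarNorm ι 2)) := by
  have h12 (h : ∀ (s t : A) (x : s ⟶ t), ∃ a : s ⟶ s, x ≫ ι.star x = a ≫ ι.star a) :
      Nonempty (FaithfulRep ι) := by
    have hpos : ι.InnerNonneg := fun s t x => by
      obtain ⟨a, ha⟩ := h s t x
      exact (star_mul_self_nonneg (show ι.Isotropy s from a)).trans_eq ha.symm
    exact ⟨hpos.faithfulRep⟩
  have h23 : Nonempty (FaithfulRep ι) → ∀ n : ℕ, Nonempty (MatCStarNorm ι n) :=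
    fun ⟨R⟩ n => ⟨R.matCStarNorm n⟩
  have h31 : Nonempty (MatCStarNorm ι 2) →
      ∀ (s t : A) (x : s ⟶ t), ∃ a : s ⟶ s, x ≫ ι.star x = a ≫ ι.star a :=
    fun ⟨ν⟩ _ _ => ι.exists_inner_self_eq fun _ _ _ _ => ν.eq_zero_of_add_eq_zero
  exact ⟨⟨h12, fun h => h31 (h23 h 2)⟩, ⟨fun h => h23 (h12 h), fun h => h31 (h 2)⟩,
    ⟨fun h => h23 (h12 h) 2, h31⟩⟩
end

section
/- Let A be a C*-algebroid with unit and let s, t be objects of A such that the unit ε_t of the isotropy C*-algebra A_t^t belongs to the closure, in (A_t^t, ‖·‖_{t,t}), of the convex cone {u_1u_1* + ⋯ + u_nu_n* : n ∈ ℕ, u_1, …, u_n ∈ A_s^t}. Then for every b ∈ A_s^t, the element b*b is a positive element of the C*-algebra A_s^s (in the usual C*-algebra sense). -/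
open CategoryTheory
open scoped ComplexOrder

universe u v w x

variable (A : Type u) [Category.{v} A]
  [∀ s t : A, NormedAddCommGroup (s ⟶ t)] [∀ s t : A, NormedSpace ℂ (s ⟶ t)]

namespace CStarAlgebroid

variable {A}

/-- The isotropy algebra of a `C*`-algebroid at an object, as a unital `C*`-algebra. -/
noncomputable abbrev isotropyCStarAlgebra [∀ s t : A, CompleteSpace (s ⟶ t)]
    (ι : CStarAlgebroid A) (s : A) : CStarAlgebra (End s) :=
  letI addGroup : NormedAddCommGroup (End s) := inferInstanceAs (NormedAddCommGroup (s ⟶ s))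
  letI space : NormedSpace ℂ (End s) := inferInstanceAs (NormedSpace ℂ (s ⟶ s))
  letI ring : NormedRing (End s) :=
    { addGroup, (inferInstance : Monoid (End s)) with
      left_distrib := fun a b c => ι.comp_add_right b c a
      right_distrib := fun a b c => ι.comp_add_left c a b
      zero_mul := fun a => by simpa using ι.comp_smul_left 0 a (0 : s ⟶ s)
      mul_zero := fun a => by simpa using ι.comp_smul_right 0 (0 : s ⟶ s) a
      norm_mul_le := fun a b => ι.norm_comp b a }
  letI algebra : Algebra ℂ (End s) :=
    Algebra.ofModule (fun c a b => ι.comp_smul_left c b a) (fun c a b => ι.comp_smul_right c b a)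
  letI normedAlgebra : NormedAlgebra ℂ (End s) :=
    { algebra with norm_smul_le := space.norm_smul_le }
  letI starRing : StarRing (End s) :=
    { star := fun a => ι.star a
      star_involutive := fun a => ι.star_star a
      star_mul := fun a b => ι.star_comp b a
      star_add := fun a b => ι.star_add a b }
  { ring, starRing, normedAlgebra with
    complete := CompleteSpace.complete (α := (s ⟶ s))
    norm_mul_self_le := fun a => by
      rw [← sq]
      exact (ι.norm_star_comp a).ge
    star_smul := fun c a => ι.star_smul c a }

end CStarAlgebroid

/-- In a unital `C*`-algebra, every limit of finite sums of elements `x* x` is again of the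
form `x* x`. -/
theorem CStarAlgebra.exists_eq_star_mul_self_of_mem_closure {R : Type*} [CStarAlgebra R] {a : R}
    (ha : a ∈ closure {c : R | ∃ (n : ℕ) (x : Fin n → R), c = ∑ j, star (x j) * x j}) :
    ∃ x : R, a = star x * x := by
  let _ : PartialOrder R := CStarAlgebra.spectralOrder R
  have : StarOrderedRing R := CStarAlgebra.spectralOrderedRing R
  refine CStarAlgebra.nonneg_iff_eq_star_mul_self.mp ?_
  refine closure_minimal (t := {c : R | 0 ≤ c}) ?_ CStarAlgebra.isClosed_nonneg ha
  rintro _ ⟨n, x, rfl⟩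
  exact Finset.sum_nonneg fun j _ => star_mul_self_nonneg (x j)

/-- Proposition 6.10 of the paper. Let `A` be a `C*`-algebroid with unit and
`s, t` objects such that the unit `ε_t = 𝟙 t` of the isotropy `C*`-algebra `A_t^t` belongs to
the closure of the convex cone generated by the elements `u u*` with `u ∈ A_s^t`.  Then for
every `b ∈ A_s^t` the element `b* b` is positive in the `C*`-algebra `A_s^s`, i.e. of the form
`c* c` with `c ∈ A_s^s`. -/
theorem cStarAlgebroid_star_mul_self_positive
    {A : Type u} [Category.{v} A]
    [∀ s t : A, NormedAddCommGroup (s ⟶ t)] [∀ s t : A, NormedSpace ℂ (s ⟶ t)]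
    [∀ s t : A, CompleteSpace (s ⟶ t)]
    (ι : CStarAlgebroid A) (s t : A)
    (hcone : (𝟙 t) ∈ closure
      {c : t ⟶ t | ∃ (n : ℕ) (u : Fin n → (s ⟶ t)), c = ∑ j, ι.star (u j) ≫ u j}) :
    ∀ b : s ⟶ t, ∃ c : s ⟶ s, b ≫ ι.star b = c ≫ ι.star c := by
  intro b
  let conj : (t ⟶ t) →+ (s ⟶ s) := AddMonoidHom.mk' (fun x => b ≫ x ≫ ι.star b) fun x y => by
    simp only [ι.comp_add_left, ι.comp_add_right]
  have hconj : Continuous conj := by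
    refine AddMonoidHomClass.continuous_of_bound conj (‖ι.star b‖ * ‖b‖) fun x => ?_
    calc ‖b ≫ x ≫ ι.star b‖ ≤ ‖x ≫ ι.star b‖ * ‖b‖ := ι.norm_comp _ _
      _ ≤ ‖ι.star b‖ * ‖x‖ * ‖b‖ := by gcongr; exact ι.norm_comp _ _
      _ = ‖ι.star b‖ * ‖b‖ * ‖x‖ := by ring
  have hmem := map_mem_closure (t := {c : s ⟶ s | ∃ (n : ℕ) (x : Fin n → (s ⟶ s)),
    c = ∑ j, x j ≫ ι.star (x j)}) hconj hcone (by
      rintro _ ⟨n, u, rfl⟩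
      refine ⟨n, fun j => b ≫ ι.star (u j), ?_⟩
      rw [map_sum]
      refine Finset.sum_congr rfl fun j _ => ?_
      simp [conj, ι.star_comp, ι.star_star])
  have hunit : conj (𝟙 t) = b ≫ ι.star b := by simp [conj]
  rw [hunit] at hmem
  let _ := ι.isotropyCStarAlgebra s
  exact CStarAlgebra.exists_eq_star_mul_self_of_mem_closure (R := End s) hmem
end

section
/- Let Γ be a semigroupoid (a set of arrows with source map d and target map c into a set S and an associative composition: for α, β ∈ Γ with c(β) = d(α) there is a composite αβ ∈ Γ with d(αβ) = d(β) and c(αβ) = c(α), satisfying α(βγ) = (αβ)γ whenever defined), let τ : S → X be a map, and for x ∈ X let ℓ²_τ(Γ; x) be the complex Hilbert space ℓ² over the set {β ∈ Γ : τ(c(β)) = x}, with canonical orthonormal basis (δ_β). For γ ∈ Γ let L(γ) be the linear operator defined on the subspace of finitely supported elements of ℓ²_τ(Γ; τ(d(γ))) with values in ℓ²_τ(Γ; τ(c(γ))) determined by L(γ)δ_β = δ_{γβ} if c(β) = d(γ) and L(γ)δ_β = 0 otherwise. Then L(γ) extends to a bounded linear operator from ℓ²_τ(Γ; τ(d(γ)))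 to ℓ²_τ(Γ; τ(c(γ))) if and only if there exists N ∈ ℕ such that for every β ∈ Γ the set {α ∈ Γ : c(α) = d(γ), γα = β} has at most N elements; and in that case ‖L(γ)‖ ≤ N. -/
open scoped Classical

universe u v w

/-- A semigroupoid in the sense of Tilson: a set of arrows `Γ` with source map `d` and target
map `c` into a set `S`, and an associative partially defined composition: `mul α β _` is the
product `αβ`, defined when `c β = d α`. -/
structure Semigroupoid (Γ : Type u) (S : Type v) where
  d : Γ → S
  c : Γ → S
  mul : ∀ (α β : Γ), c β = d α → Γ
  d_mul : ∀ (α β : Γ) (h : c β = d α), d (mul α β h) = d β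
  c_mul : ∀ (α β : Γ) (h : c β = d α), c (mul α β h) = c α
  assoc : ∀ (α β γ : Γ) (h₁ : c β = d α) (h₂ : c γ = d β)
    (h₃ : c (mul β γ h₂) = d α) (h₄ : c γ = d (mul α β h₁)),
    mul α (mul β γ h₂) h₃ = mul (mul α β h₁) γ h₄

/-- If the fibres of the partial map `f : ι → Option κ` over `κ` have at most `N` elements, then
pulling back a square-summable function along `f` multiplies its squared norm by at most `N`. -/
theorem sum_sq_norm_elim_le {ι : Type u} {κ : Type v} (f : ι → Option κ) (N : ℕ)
    (hf : ∀ (k : κ) (s : Finset ι), (∀ i ∈ s, f i = some k) → s.card ≤ N)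
    (g : lp (fun _ : κ => ℂ) 2) (s : Finset ι) :
    ∑ i ∈ s, ‖(f i).elim (0 : ℂ) g‖ ^ 2 ≤ N * ‖g‖ ^ 2 := by
  rw [Finset.sum_comp (fun o : Option κ => ‖o.elim (0 : ℂ) g‖ ^ 2) f]
  calc _ ≤ ∑ o ∈ s.image f, N * o.elim' 0 (fun k => ‖g k‖ ^ 2) := by
        refine Finset.sum_le_sum fun o _ => ?_
        cases o with
        | none => simp
        | some k =>
          rw [nsmul_eq_mul]
          refine mul_le_mul_of_nonneg_right ?_ (by simp)
          exact_mod_cast hf k _ fun i hi => (Finset.mem_filter.mp hi).2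
    _ = N * ∑ k ∈ (s.image f).eraseNone, ‖g k‖ ^ 2 := by
        rw [← Finset.mul_sum, Finset.sum_eraseNone]
    _ ≤ N * ‖g‖ ^ 2 := by
        gcongr
        simpa using lp.sum_rpow_le_norm_rpow (p := 2) (by simp) g (s.image f).eraseNone

/-- The pullback operator `ℓ²(κ) → ℓ²(ι)` along a partial map with uniformly finite fibres. -/
theorem exists_pullback_lp {ι : Type u} {κ : Type v} (f : ι → Option κ) (N : ℕ)
    (hf : ∀ (k : κ) (s : Finset ι), (∀ i ∈ s, f i = some k) → s.card ≤ N) :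
    ∃ A : lp (fun _ : κ => ℂ) 2 →L[ℂ] lp (fun _ : ι => ℂ) 2,
      (∀ g i, A g i = (f i).elim 0 g) ∧ ‖A‖ ≤ √N := by
  have key := sum_sq_norm_elim_le f N hf
  let A : lp (fun _ : κ => ℂ) 2 →ₗ[ℂ] lp (fun _ : ι => ℂ) 2 :=
    { toFun g := ⟨fun i => (f i).elim 0 g,
        memℓp_gen' (C := N * ‖g‖ ^ 2) fun s => by simpa using key g s⟩
      map_add' g h := by
        ext i
        change (f i).elim 0 ⇑(g + h) = (f i).elim 0 g + (f i).elim 0 h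
        cases f i with
        | none => exact (add_zero _).symm
        | some k => rfl
      map_smul' a g := by
        ext i
        change (f i).elim 0 ⇑(a • g) = a • (f i).elim 0 g
        cases f i <;> simp }
  have hA : ∀ g, ‖A g‖ ≤ √N * ‖g‖ := fun g => by
    refine lp.norm_le_of_forall_sum_le (by simp) (by positivity) fun s => ?_
    have : (√N * ‖g‖) ^ 2 = N * ‖g‖ ^ 2 := by rw [mul_pow, Real.sq_sqrt (by positivity)]
    simpa [this, A] using key g s
  exact ⟨A.mkContinuous _ hA, fun _ _ => rfl, A.mkContinuous_norm_le (by positivity) hA⟩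

/-- A partial map with fibres of at most `N` elements induces an operator on `ℓ²` sending
basis vectors to basis vectors or to `0`, of norm at most `√N`. -/
theorem exists_pushforward_lp {ι : Type u} {κ : Type v} [DecidableEq ι] [DecidableEq κ]
    (f : ι → Option κ) (N : ℕ)
    (hf : ∀ (k : κ) (s : Finset ι), (∀ i ∈ s, f i = some k) → s.card ≤ N) :
    ∃ B : lp (fun _ : ι => ℂ) 2 →L[ℂ] lp (fun _ : κ => ℂ) 2,
      (∀ i, B (lp.single 2 i 1) = (f i).elim 0 fun k => lp.single 2 k 1) ∧ ‖B‖ ≤ √N := by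
  obtain ⟨A, hA, hAN⟩ := exists_pullback_lp f N hf
  refine ⟨ContinuousLinearMap.adjoint A, fun i => ext_inner_right ℂ fun g => ?_, by
    rwa [LinearIsometryEquiv.norm_map]⟩
  rw [ContinuousLinearMap.adjoint_inner_left, lp.inner_single_left, hA]
  cases f i <;> simp [lp.inner_single_left]

/-- A bounded operator sending `n` distinct basis vectors to the same basis vector has squared
norm at least `n`. -/
theorem card_le_sq_norm_of_map_single_eq {ι : Type u} {κ : Type v}
    [DecidableEq ι] [DecidableEq κ]
    (B : lp (fun _ : ι => ℂ) 2 →L[ℂ] lp (fun _ : κ => ℂ) 2) (k : κ) (s : Finset ι)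
    (hs : ∀ i ∈ s, B (lp.single 2 i 1) = lp.single 2 k 1) : (s.card : ℝ) ≤ ‖B‖ ^ 2 := by
  have hnorm : ‖∑ i ∈ s, lp.single (E := fun _ : ι => ℂ) 2 i 1‖ ^ 2 = s.card := by
    simpa using lp.norm_sum_single (E := fun _ : ι => ℂ) (p := 2) (by simp) (fun _ => 1) s
  have hB : ‖B (∑ i ∈ s, lp.single 2 i 1)‖ = s.card := by
    rw [map_sum, Finset.sum_congr rfl hs, Finset.sum_const, ← Nat.cast_smul_eq_nsmul ℂ,
      norm_smul, lp.norm_single (by simp)]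
    simp
  have hle := pow_le_pow_left₀ (norm_nonneg _) (B.le_opNorm (∑ i ∈ s, lp.single 2 i 1)) 2
  rw [hB, mul_pow, hnorm] at hle
  rcases (Nat.cast_nonneg (α := ℝ) s.card).eq_or_lt with h0 | h0
  · rw [← h0]
    positivity
  · nlinarith

theorem Set.finite_and_ncard_le_of_forall_finset {α : Type u} {t : Set α} {N : ℕ}
    (h : ∀ s : Finset α, ↑s ⊆ t → s.card ≤ N) : t.Finite ∧ t.ncard ≤ N := by
  have ht : t.Finite := by
    by_contra hinf
    obtain ⟨s, hst, hs⟩ := Set.Infinite.exists_subset_card_eq hinf (N + 1)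
    have := h s hst
    omega
  refine ⟨ht, ?_⟩
  rw [Set.ncard_eq_toFinset_card t ht]
  exact h _ (by simp)

/-- Example 2.19 (d) of the paper. Let `Γ` be a semigroupoid, `τ : S → X` an
aggregation map, and `ℓ²_τ(Γ; x)` the Hilbert space `ℓ²` over `{β ∈ Γ : τ(c β) = x}`.  For
`γ ∈ Γ`, the left-regular operator `L(γ)`, determined on basis vectors by `L(γ) δ_β = δ_{γβ}`
when `c β = d γ` and `L(γ) δ_β = 0` otherwise, extends to a bounded linear operator
`ℓ²_τ(Γ; τ(d γ)) → ℓ²_τ(Γ; τ(c γ))` if and only if there is `N ∈ ℕ` bounding the cardinality of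
every fibre `m_γ⁻¹({β}) = {α : c α = d γ, γα = β}`; and in that case `‖L(γ)‖ ≤ N`. -/
theorem leftRegular_bounded_iff
    {Γ : Type u} {S : Type v} {X : Type w} (G : Semigroupoid Γ S) (τ : S → X) (γ : Γ) :
    ((∃ B : lp (fun _ : {β : Γ // τ (G.c β) = τ (G.d γ)} => ℂ) 2 →L[ℂ]
          lp (fun _ : {β : Γ // τ (G.c β) = τ (G.c γ)} => ℂ) 2,
        ∀ (β : Γ) (hβ : τ (G.c β) = τ (G.d γ)),
          B (lp.single 2 ⟨β, hβ⟩ 1) =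
            if h : G.c β = G.d γ then
              lp.single 2 ⟨G.mul γ β h, by rw [G.c_mul]⟩ 1
            else 0) ↔
      (∃ N : ℕ, ∀ β : Γ,
        ({α : Γ | ∃ h : G.c α = G.d γ, G.mul γ α h = β}).Finite ∧
        ({α : Γ | ∃ h : G.c α = G.d γ, G.mul γ α h = β}).ncard ≤ N)) ∧
    (∀ N : ℕ,
      (∀ β : Γ,
        ({α : Γ | ∃ h : G.c α = G.d γ, G.mul γ α h = β}).Finite ∧
        ({α : Γ | ∃ h : G.c α = G.d γ, G.mul γ α h = β}).ncard ≤ N) →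
      ∃ B : lp (fun _ : {β : Γ // τ (G.c β) = τ (G.d γ)} => ℂ) 2 →L[ℂ]
          lp (fun _ : {β : Γ // τ (G.c β) = τ (G.c γ)} => ℂ) 2,
        (∀ (β : Γ) (hβ : τ (G.c β) = τ (G.d γ)),
          B (lp.single 2 ⟨β, hβ⟩ 1) =
            if h : G.c β = G.d γ then
              lp.single 2 ⟨G.mul γ β h, by rw [G.c_mul]⟩ 1
            else 0) ∧
        ‖B‖ ≤ (N : ℝ)) := by
  have bounded_of_fibre : ∀ N : ℕ, (∀ β : Γ,
      ({α : Γ | ∃ h : G.c α = G.d γ, G.mul γ α h = β}).Finite ∧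
      ({α : Γ | ∃ h : G.c α = G.d γ, G.mul γ α h = β}).ncard ≤ N) →
      ∃ B : lp (fun _ : {β : Γ // τ (G.c β) = τ (G.d γ)} => ℂ) 2 →L[ℂ]
          lp (fun _ : {β : Γ // τ (G.c β) = τ (G.c γ)} => ℂ) 2,
        (∀ (β : Γ) (hβ : τ (G.c β) = τ (G.d γ)),
          B (lp.single 2 ⟨β, hβ⟩ 1) =
            if h : G.c β = G.d γ then
              lp.single 2 ⟨G.mul γ β h, by rw [G.c_mul]⟩ 1
            else 0) ∧
        ‖B‖ ≤ (N : ℝ) := by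
    intro N hN
    let f : {β : Γ // τ (G.c β) = τ (G.d γ)} → Option {β : Γ // τ (G.c β) = τ (G.c γ)} :=
      fun β => if h : G.c β.1 = G.d γ then some ⟨G.mul γ β.1 h, by rw [G.c_mul]⟩ else none
    obtain ⟨B, hB, hBN⟩ := exists_pushforward_lp f N fun k s hs => by
      rw [← Finset.card_map (Function.Embedding.subtype _), ← Set.ncard_coe_finset]
      refine (Set.ncard_le_ncard ?_ (hN k.1).1).trans (hN k.1).2
      intro α hα
      obtain ⟨i, hi, rfl⟩ := Finset.mem_map.mp hα
      have hik := hs i hi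
      by_cases h : G.c i.1 = G.d γ
      · simp only [f, dif_pos h, Option.some.injEq] at hik
        exact ⟨h, congrArg Subtype.val hik⟩
      · simp [f, dif_neg h] at hik
    refine ⟨B, fun β hβ => ?_, hBN.trans ?_⟩
    · rw [hB]
      by_cases h : G.c β = G.d γ <;> simp [f, h]
    · refine (Real.sqrt_le_left (Nat.cast_nonneg N)).2 ?_
      exact_mod_cast Nat.le_self_pow two_ne_zero N
  refine ⟨⟨?_, fun ⟨N, hN⟩ => (bounded_of_fibre N hN).imp fun _ h => h.1⟩, bounded_of_fibre⟩
  rintro ⟨B, hB⟩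
  refine ⟨⌊‖B‖ ^ 2⌋₊, fun β => Set.finite_and_ncard_le_of_forall_finset fun t ht => ?_⟩
  rcases t.eq_empty_or_nonempty with rfl | ⟨α₀, hα₀⟩
  · simp
  obtain ⟨h₀, rfl⟩ := ht hα₀
  have hτ : ∀ α ∈ t, τ (G.c α) = τ (G.d γ) := fun α hα => congrArg τ (ht hα).1
  have hcard : (t.subtype fun α => τ (G.c α) = τ (G.d γ)).card = t.card := by
    rw [Finset.card_subtype, Finset.filter_true_of_mem hτ]
  rw [← hcard]
  refine Nat.le_floor (card_le_sq_norm_of_map_single_eq B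
    ⟨G.mul γ α₀ h₀, by rw [G.c_mul]⟩ _ fun i hi => ?_)
  obtain ⟨h, hmul⟩ := ht (Finset.mem_subtype.mp hi)
  rw [hB i.1 i.2, dif_pos h]
  simp only [hmul]
end
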